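/- (Monotonicity of the 1D fourth-order scheme.) Set a = (h/(2μ))·‖u‖_∞. If a < (√37 − 5)/4 and Δt·μ/h² ≥ (2a + 1)/(6 − 20a − 8a²) (equivalently c ≤ (6 − 20a − 8a²)/(2a + 1)), then the scaled 1D fourth-order scheme matrix A is invertible and every entry of A^{-1} is non-negative; equivalently, the unscaled scheme matrix L̄ = (1/c)A is inverse-positive. In particular these hypotheses hold whenever h·‖u‖_∞/μ ≤ 1/2 and Δt·μ/h² ≥ 3. -/

import Mathlib

open Matrix

/-- The scaled 1D fourth-order scheme matrix `A = (h²/(μΔt))·L̄`: with `c = h²/(μΔt)`,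
rows `0` and `n+1` are `c` on the diagonal; an odd interior row `i` (cell center) realizes
`c·φᵢ + (h·uᵢ/(2μ))(φᵢ₊₁ - φᵢ₋₁) + (-φᵢ₋₁ + 2φᵢ - φᵢ₊₁)`; an even interior row `i`
(cell end) realizes
`c·φᵢ + (h·uᵢ/(4μ))(φᵢ₋₂ - 4φᵢ₋₁ + 4φᵢ₊₁ - φᵢ₊₂) + (φᵢ₋₂ - 8φᵢ₋₁ + 14φᵢ - 8φᵢ₊₁ + φᵢ₊₂)/4`. -/
noncomputable def schemeA1D (n : ℕ) (h μ Δt : ℝ) (u : ℕ → ℝ) :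
    Matrix (Fin (n + 2)) (Fin (n + 2)) ℝ :=
  Matrix.of fun i j =>
    if (i : ℕ) = 0 ∨ (i : ℕ) = n + 1 then
      (if (j : ℕ) = (i : ℕ) then h ^ 2 / (μ * Δt) else 0)
    else if Odd (i : ℕ) then
      if (j : ℕ) = (i : ℕ) - 1 then -(h * u (i : ℕ) / (2 * μ)) - 1
      else if (j : ℕ) = (i : ℕ) then h ^ 2 / (μ * Δt) + 2
      else if (j : ℕ) = (i : ℕ) + 1 then h * u (i : ℕ) / (2 * μ) - 1
      else 0
    else
      if (j : ℕ) = (i : ℕ) - 2 then h * u (i : ℕ) / (4 * μ) + 1 / 4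
      else if (j : ℕ) = (i : ℕ) - 1 then -(h * u (i : ℕ) / μ) - 2
      else if (j : ℕ) = (i : ℕ) then h ^ 2 / (μ * Δt) + 7 / 2
      else if (j : ℕ) = (i : ℕ) + 1 then h * u (i : ℕ) / μ - 2
      else if (j : ℕ) = (i : ℕ) + 2 then -(h * u (i : ℕ) / (4 * μ)) + 1 / 4
      else 0

/-- Discrete minimum principle behind the monotonicity of the scheme: a grid function with
non-negative residuals is non-negative. Here `b i` stands for `h·uᵢ/(2μ)`. -/
theorem nonneg_of_scheme_residual_nonneg {n : ℕ} (hodd : Odd n) {c a : ℝ} (hc : 0 < c)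
    (ha : a < 1 / 2) {b f : ℕ → ℝ} (hb : ∀ i, 1 ≤ i → i ≤ n → |b i| ≤ a)
    (hca : (c + 2) * (1 + 2 * a) ≤ 8 - 16 * a - 8 * a ^ 2)
    (hfirst : 0 ≤ c * f 0) (hlast : 0 ≤ c * f (n + 1))
    (hcenter : ∀ i, 1 ≤ i → i ≤ n → Odd i →
      0 ≤ (-b i - 1) * f (i - 1) + (c + 2) * f i + (b i - 1) * f (i + 1))
    (hend : ∀ i, 1 ≤ i → i ≤ n → ¬ Odd i →
      0 ≤ (b i / 2 + 1 / 4) * f (i - 2) + (-(2 * b i) - 2) * f (i - 1) + (c + 7 / 2) * f i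
        + (2 * b i - 2) * f (i + 1) + (-(b i / 2) + 1 / 4) * f (i + 2))
    (i : ℕ) (hi : i ≤ n + 1) : 0 ≤ f i := by
  obtain ⟨k, hk, hmin⟩ := Finset.exists_min_image (Finset.range (n + 2)) f ⟨0, by simp⟩
  simp only [Finset.mem_range] at hk hmin
  suffices hfk : 0 ≤ f k from hfk.trans (hmin i (by omega))
  by_contra! hneg
  have hck : c * f k < 0 := mul_neg_of_pos_of_neg hc hneg
  have hψ : ∀ j, j ≤ n + 1 → 0 ≤ f j - f k := fun j hj => sub_nonneg.2 (hmin j (by omega))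
  have hcenter_pos : ∀ j, 1 ≤ j → j ≤ n → Odd j →
      0 < (-b j - 1) * (f (j - 1) - f k) + (c + 2) * (f j - f k)
        + (b j - 1) * (f (j + 1) - f k) := by
    intro j h1 h2 h3
    linarith [hcenter j h1 h2 h3]
  have heven_pos : ∀ j, j ≤ n + 1 → ¬ Odd j → 0 < f j - f k := by
    intro j hj hje
    rcases Nat.eq_zero_or_pos j with rfl | hj0
    · exact pos_of_mul_pos_right (by linarith : 0 < c * (f 0 - f k)) hc.le
    rcases eq_or_lt_of_le hj with rfl | hjn
    · exact pos_of_mul_pos_right (by linarith : 0 < c * (f (n + 1) - f k)) hc.le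
    obtain ⟨l, rfl⟩ : ∃ l, j = l + 2 := by
      rcases Nat.not_odd_iff_even.1 hje with ⟨l, rfl⟩
      exact ⟨l + l - 2, by omega⟩
    have hln : l + 4 ≤ n + 1 := by
      obtain ⟨p, rfl⟩ := hodd
      obtain ⟨q, hq⟩ := Nat.not_odd_iff_even.1 hje
      omega
    have hl : ¬ Odd l := by
      rintro ⟨p, rfl⟩
      exact hje ⟨p + 1, by ring⟩
    have hrow : 0 < (b (l + 2) / 2 + 1 / 4) * (f l - f k)
        + (-(2 * b (l + 2)) - 2) * (f (l + 1) - f k) + (c + 7 / 2) * (f (l + 2) - f k)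
        + (2 * b (l + 2) - 2) * (f (l + 3) - f k)
        + (-(b (l + 2) / 2) + 1 / 4) * (f (l + 4) - f k) := by
      have := hend (l + 2) (by omega) (by omega) hje
      simp only [Nat.add_sub_cancel, show l + 2 - 1 = l + 1 by omega] at this
      linarith
    have hleft := hcenter_pos (l + 1) (by omega) (by omega) (by
      simpa [Nat.even_add_one, Nat.odd_add_one] using hl)
    have hright := hcenter_pos (l + 3) (by omega) (by omega) (by
      rcases Nat.not_odd_iff_even.1 hl with ⟨p, rfl⟩
      exact ⟨p + 1, by ring⟩)
    simp only [Nat.add_sub_cancel, show l + 3 - 1 = l + 2 by omega] at hleft hright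
    obtain ⟨hbl, hbu⟩ := abs_le.1 (hb (l + 2) (by omega) (by omega))
    obtain ⟨hbl1, hbu1⟩ := abs_le.1 (hb (l + 1) (by omega) (by omega))
    obtain ⟨hbl3, hbu3⟩ := abs_le.1 (hb (l + 3) (by omega) (by omega))
    have h0 := hψ l (by omega)
    have h1 := hψ (l + 1) (by omega)
    have h2 := hψ (l + 2) (by omega)
    have h3 := hψ (l + 3) (by omega)
    have h4 := hψ (l + 4) (by omega)
    generalize f l - f k = x0 at *
    generalize f (l + 1) - f k = x1 at *
    generalize f (l + 2) - f k = x2 at *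
    generalize f (l + 3) - f k = x3 at *
    generalize f (l + 4) - f k = x4 at *
    generalize b (l + 1) = b1 at *
    generalize b (l + 2) = b2 at *
    generalize b (l + 3) = b3 at *
    have hα : 0 < 1 / 4 + b2 / 2 := by linarith
    have hβ : 0 < 1 / 4 - b2 / 2 := by linarith
    -- combine the row at `l + 2` with its two neighbouring rows to cancel the other entries
    have e0 : 0 ≤ (1 / 4 + b2 / 2) * (a + b1) * x0 :=
      mul_nonneg (mul_nonneg hα.le (by linarith)) h0
    have e4 : 0 ≤ (1 / 4 - b2 / 2) * (a - b3) * x4 :=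
      mul_nonneg (mul_nonneg hβ.le (by linarith)) h4
    have e1 : 0 ≤ ((2 + 2 * b2) * (1 - a) - (1 / 4 + b2 / 2) * (c + 2)) * x1 :=
      mul_nonneg (by nlinarith) h1
    have e3 : 0 ≤ ((2 - 2 * b2) * (1 - a) - (1 / 4 - b2 / 2) * (c + 2)) * x3 :=
      mul_nonneg (by nlinarith) h3
    have e2 : 0 ≤ ((1 / 4 + b2 / 2) * (1 - b1) + (1 / 4 - b2 / 2) * (1 + b3)) * x2 :=
      mul_nonneg (add_nonneg (mul_nonneg hα.le (by linarith))
        (mul_nonneg hβ.le (by linarith))) h2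
    have hd : 0 < (1 - a) * (c + 7 / 2) := mul_pos (by linarith) (by linarith)
    have hr := mul_pos (by linarith : 0 < 1 - a) hrow
    have hrl := mul_pos hα hleft
    have hrr := mul_pos hβ hright
    exact pos_of_mul_pos_right (by linarith : 0 < (1 - a) * (c + 7 / 2) * x2) hd.le
  have hpos : ∀ j, j ≤ n + 1 → 0 < f j - f k := by
    intro j hj
    by_cases hje : Odd j
    · have hjn : j ≤ n := by
        obtain ⟨p, rfl⟩ := hodd
        obtain ⟨q, rfl⟩ := hje
        omega
      obtain ⟨l, rfl⟩ : ∃ l, j = l + 1 := ⟨j - 1, by have := hje.pos; omega⟩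
      have hrow := hcenter_pos (l + 1) (by omega) hjn hje
      simp only [Nat.add_sub_cancel] at hrow
      obtain ⟨hbl, hbu⟩ := abs_le.1 (hb (l + 1) (by omega) hjn)
      have e0 := mul_nonneg (by linarith : 0 ≤ 1 + b (l + 1)) (hψ l (by omega))
      have e2 := mul_nonneg (by linarith : 0 ≤ 1 - b (l + 1)) (hψ (l + 1 + 1) (by omega))
      exact pos_of_mul_pos_right (by linarith : 0 < (c + 2) * (f (l + 1) - f k)) (by linarith)
    · exact heven_pos j hj hje
  exact absurd (hpos k (by omega)) (by simp)

/-- A square matrix that reflects non-negativity of vectors is inverse-positive. -/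
theorem Matrix.isUnit_det_and_inv_nonneg_of_monotone {ι : Type*} [Fintype ι] [DecidableEq ι]
    {A : Matrix ι ι ℝ} (hA : ∀ v : ι → ℝ, 0 ≤ A *ᵥ v → 0 ≤ v) :
    IsUnit A.det ∧ ∀ i j, 0 ≤ A⁻¹ i j := by
  have hdet : IsUnit A.det := by
    rw [isUnit_iff_ne_zero]
    intro h0
    obtain ⟨v, hv, hAv⟩ := Matrix.exists_mulVec_eq_zero_iff.2 h0
    refine hv (le_antisymm ?_ (hA v hAv.ge))
    exact neg_nonneg.1 (hA (-v) (by rw [Matrix.mulVec_neg, hAv, neg_zero]))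
  refine ⟨hdet, fun i j => ?_⟩
  have hcol := hA (A⁻¹ *ᵥ Pi.single j 1) (by
    rw [Matrix.mulVec_mulVec, Matrix.mul_nonsing_inv _ hdet, Matrix.one_mulVec]
    exact Pi.single_nonneg.2 zero_le_one)
  simpa using hcol i

section Rows

variable {n : ℕ} {h μ Δt : ℝ} {u f : ℕ → ℝ} {i : ℕ}

theorem schemeA1D_mulVec_boundary (hi : i = 0 ∨ i = n + 1) (hin : i < n + 2) :
    (schemeA1D n h μ Δt u *ᵥ fun j => f j) ⟨i, hin⟩ = h ^ 2 / (μ * Δt) * f i := by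
  simp only [Matrix.mulVec, dotProduct, schemeA1D, Matrix.of_apply, if_pos hi]
  rw [Fin.sum_univ_eq_sum_range
    (fun j => (if j = i then h ^ 2 / (μ * Δt) else 0) * f j) (n + 2)]
  simp [ite_mul, hin]

theorem schemeA1D_mulVec_center (h1 : 1 ≤ i) (h2 : i ≤ n) (hi : Odd i) :
    (schemeA1D n h μ Δt u *ᵥ fun j => f j) ⟨i, by omega⟩ =
      (-(h * u i / (2 * μ)) - 1) * f (i - 1) + (h ^ 2 / (μ * Δt) + 2) * f i
        + (h * u i / (2 * μ) - 1) * f (i + 1) := by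
  simp only [Matrix.mulVec, dotProduct, schemeA1D, Matrix.of_apply,
    if_neg (show ¬ (i = 0 ∨ i = n + 1) by omega), if_pos hi]
  rw [Fin.sum_univ_eq_sum_range
    (fun j => (if j = i - 1 then -(h * u i / (2 * μ)) - 1
      else if j = i then h ^ 2 / (μ * Δt) + 2
      else if j = i + 1 then h * u i / (2 * μ) - 1 else 0) * f j) (n + 2)]
  trans ∑ j ∈ Finset.range (n + 2),
    ((if j = i - 1 then (-(h * u i / (2 * μ)) - 1) * f j else 0)
      + (if j = i then (h ^ 2 / (μ * Δt) + 2) * f j else 0)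
      + (if j = i + 1 then (h * u i / (2 * μ) - 1) * f j else 0))
  · refine Finset.sum_congr rfl fun j _ => ?_
    split_ifs <;> first | omega | ring
  · simp only [Finset.sum_add_distrib, Finset.sum_ite_eq', Finset.mem_range]
    rw [if_pos (by omega), if_pos (by omega), if_pos (by omega)]

theorem schemeA1D_mulVec_end (hn : Odd n) (h1 : 1 ≤ i) (h2 : i ≤ n) (hi : ¬ Odd i) :
    (schemeA1D n h μ Δt u *ᵥ fun j => f j) ⟨i, by omega⟩ =
      (h * u i / (4 * μ) + 1 / 4) * f (i - 2) + (-(h * u i / μ) - 2) * f (i - 1)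
        + (h ^ 2 / (μ * Δt) + 7 / 2) * f i + (h * u i / μ - 2) * f (i + 1)
        + (-(h * u i / (4 * μ)) + 1 / 4) * f (i + 2) := by
  obtain ⟨hi2, hin⟩ : 2 ≤ i ∧ i + 1 ≤ n := by
    obtain ⟨p, rfl⟩ := hn
    obtain ⟨q, rfl⟩ := Nat.not_odd_iff_even.1 hi
    omega
  simp only [Matrix.mulVec, dotProduct, schemeA1D, Matrix.of_apply,
    if_neg (show ¬ (i = 0 ∨ i = n + 1) by omega), if_neg hi]
  rw [Fin.sum_univ_eq_sum_range
    (fun j => (if j = i - 2 then h * u i / (4 * μ) + 1 / 4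
      else if j = i - 1 then -(h * u i / μ) - 2
      else if j = i then h ^ 2 / (μ * Δt) + 7 / 2
      else if j = i + 1 then h * u i / μ - 2
      else if j = i + 2 then -(h * u i / (4 * μ)) + 1 / 4 else 0) * f j) (n + 2)]
  trans ∑ j ∈ Finset.range (n + 2),
    ((if j = i - 2 then (h * u i / (4 * μ) + 1 / 4) * f j else 0)
      + (if j = i - 1 then (-(h * u i / μ) - 2) * f j else 0)
      + (if j = i then (h ^ 2 / (μ * Δt) + 7 / 2) * f j else 0)
      + (if j = i + 1 then (h * u i / μ - 2) * f j else 0)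
      + (if j = i + 2 then (-(h * u i / (4 * μ)) + 1 / 4) * f j else 0))
  · refine Finset.sum_congr rfl fun j _ => ?_
    split_ifs <;> first | omega | ring
  · simp only [Finset.sum_add_distrib, Finset.sum_ite_eq', Finset.mem_range]
    rw [if_pos (by omega), if_pos (by omega), if_pos (by omega), if_pos (by omega),
      if_pos (by omega)]

end Rows

/-- Theorem 3.7 in the paper (monotonicity of the 1D fourth-order scheme): with
`a = (h/(2μ))·‖u‖_∞`, if `a < (√37 - 5)/4` and `Δt·μ/h² ≥ (2a+1)/(6 - 20a - 8a²)`, then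
the scaled scheme matrix `A` (equivalently the unscaled matrix `L̄ = (1/c)A`) is
inverse-positive. -/
theorem schemeA1D_inverse_positive
    (n : ℕ) (hodd : Odd n) (hn : 3 ≤ n)
    (h μ Δt : ℝ) (hh : 0 < h) (hμ : 0 < μ) (hΔt : 0 < Δt)
    (u : ℕ → ℝ) (m a : ℝ)
    (hm : IsGreatest {x : ℝ | ∃ i : ℕ, 1 ≤ i ∧ i ≤ n ∧ x = |u i|} m)
    (ha : a = h / (2 * μ) * m)
    (ha' : a < (Real.sqrt 37 - 5) / 4)
    (hdt : Δt * μ / h ^ 2 ≥ (2 * a + 1) / (6 - 20 * a - 8 * a ^ 2)) :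
    IsUnit (schemeA1D n h μ Δt u).det ∧ ∀ i j, 0 ≤ (schemeA1D n h μ Δt u)⁻¹ i j := by
  have hmu : ∀ i, 1 ≤ i → i ≤ n → |u i| ≤ m := fun i h1 h2 => hm.2 ⟨i, h1, h2, rfl⟩
  have hm0 : 0 ≤ m := (abs_nonneg _).trans (hmu 1 le_rfl (by omega))
  have ha0 : 0 ≤ a := ha ▸ by positivity
  have hK : 0 < 6 - 20 * a - 8 * a ^ 2 := by
    nlinarith [Real.sq_sqrt (show (0 : ℝ) ≤ 37 by norm_num), Real.sqrt_nonneg 37]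
  have hc : 0 < h ^ 2 / (μ * Δt) := by positivity
  have hca : h ^ 2 / (μ * Δt) * (2 * a + 1) ≤ 6 - 20 * a - 8 * a ^ 2 := by
    rw [ge_iff_le, div_le_div_iff₀ hK (by positivity)] at hdt
    rw [div_mul_eq_mul_div, div_le_iff₀ (by positivity)]
    linarith
  have hb : ∀ i, 1 ≤ i → i ≤ n → |h * u i / (2 * μ)| ≤ a := by
    intro i h1 h2
    rw [mul_div_right_comm, abs_mul, abs_of_pos (by positivity), ha]
    exact mul_le_mul_of_nonneg_left (hmu i h1 h2) (by positivity)
  refine Matrix.isUnit_det_and_inv_nonneg_of_monotone fun v hv k => ?_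
  obtain ⟨f, rfl⟩ : ∃ f : ℕ → ℝ, v = fun j : Fin (n + 2) => f j :=
    ⟨fun j => if hj : j < n + 2 then v ⟨j, hj⟩ else 0, by ext j; simp⟩
  refine nonneg_of_scheme_residual_nonneg hodd hc (by nlinarith) hb (by nlinarith)
    ?_ ?_ ?_ ?_ k (by omega)
  · rw [← schemeA1D_mulVec_boundary (u := u) (Or.inl rfl) (by omega)]
    exact hv _
  · rw [← schemeA1D_mulVec_boundary (u := u) (Or.inr rfl) (by omega)]
    exact hv _
  · intro i h1 h2 hi
    rw [← schemeA1D_mulVec_center h1 h2 hi]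
    exact hv _
  · intro i h1 h2 hi
    have hrow := hv ⟨i, by omega⟩
    rw [schemeA1D_mulVec_end hodd h1 h2 hi, Pi.zero_apply] at hrow
    have h4 : h * u i / (2 * μ) / 2 = h * u i / (4 * μ) := by ring
    have h1' : 2 * (h * u i / (2 * μ)) = h * u i / μ := by ring
    rwa [h4, h1']
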